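/- (Theorem 1) Consider the unit square [0,1]×[0,1] in ℝ², a contact line {ξ⁰}×[0,1] with 0 < ξ⁰ < 1, contact points ξ⁻, ξ⁺ with 0 < ξ⁻ < ξ⁰ < ξ⁺ < 1, and constants γ⁻ > 0, γ⁺ > 0 with γ⁻ + γ⁺ ≤ 1. Suppose f⁻ : ℝ² → ℝ, f⁺ : ℝ² → ℝ and φ₀ : ℝ → ℝ are C^∞ functions with f⁻(x₁,0) = f⁻(x₁,1) = f⁺(x₁,0) = f⁺(x₁,1) = 0 and φ₀(0) = φ₀(1) = 0. Then there exists exactly one regular solution of the nonlocal contact problem: a continuous function u on [0,1]×[0,1] whose restriction u⁻ to (0,ξ⁰)×(0,1) is C² with Δu⁻ = f⁻ there, whose restriction u⁺ to (ξ⁰,1)×(0,1) is C² with Δu⁺ = f⁺ there, which vanishes on all four sides of the square (u(x₁,0) = u(x₁,1) = 0 for 0 ≤ x₁ ≤ 1 and u(0,x₂) = u(1,x₂) = 0 for 0 ≤ x₂ ≤ 1), and which satisfies the nonlocal contact condition u(ξ⁰,x₂) = γ⁻·u(ξ⁻,x₂) + γ⁺·u(ξ⁺,x₂) + φ₀(x₂)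 for 0 ≤ x₂ ≤ 1. -/

import Mathlib

open Set

/-- The Laplace operator `Δu = ∂²u/∂x₁² + ∂²u/∂x₂²` of a function on `ℝ²`. -/
noncomputable def laplacian2 (u : ℝ × ℝ → ℝ) (p : ℝ × ℝ) : ℝ :=
  deriv (deriv (fun s => u (s, p.2))) p.1 + deriv (deriv (fun s => u (p.1, s))) p.2

/-- A regular solution of the nonlocal contact problem for the Poisson equation
on the unit square: continuous on the closed square, `C²` with `Δu⁻ = f⁻` on the
left open subdomain, `C²` with `Δu⁺ = f⁺` on the right open subdomain, vanishing
on the four sides, and satisfying the nonlocal contact condition. -/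
def IsRegSolPoisson (ξm ξ0 ξp γm γp : ℝ) (fm fp : ℝ × ℝ → ℝ) (φ0 : ℝ → ℝ)
    (u : ℝ × ℝ → ℝ) : Prop :=
  ContinuousOn u (Icc 0 1 ×ˢ Icc 0 1) ∧
  ContDiffOn ℝ 2 u (Ioo 0 ξ0 ×ˢ Ioo 0 1) ∧
  ContDiffOn ℝ 2 u (Ioo ξ0 1 ×ˢ Ioo 0 1) ∧
  (∀ p ∈ Ioo 0 ξ0 ×ˢ Ioo (0:ℝ) 1, laplacian2 u p = fm p) ∧
  (∀ p ∈ Ioo ξ0 1 ×ˢ Ioo (0:ℝ) 1, laplacian2 u p = fp p) ∧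
  (∀ x₁ ∈ Icc (0:ℝ) 1, u (x₁, 0) = 0 ∧ u (x₁, 1) = 0) ∧
  (∀ x₂ ∈ Icc (0:ℝ) 1, u (0, x₂) = 0 ∧ u (1, x₂) = 0) ∧
  (∀ x₂ ∈ Icc (0:ℝ) 1, u (ξ0, x₂) = γm * u (ξm, x₂) + γp * u (ξp, x₂) + φ0 x₂)

theorem deriv_deriv_nonpos_of_isLocalMax {f : ℝ → ℝ} {x : ℝ} (h : IsLocalMax f x)
    (hc : ContinuousAt f x) : deriv (deriv f) x ≤ 0 := by
  by_contra! hpos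
  have hmin := isLocalMin_of_deriv_deriv_pos hpos h.deriv_eq_zero hc
  have hconst : f =ᶠ[nhds x] fun _ => f x := by
    filter_upwards [h, hmin] with y hy hy'
    exact le_antisymm hy hy'
  rw [hconst.deriv.deriv_eq] at hpos
  simp at hpos

theorem deriv_deriv_sub {f g : ℝ → ℝ} {x : ℝ} (hf : ContDiffAt ℝ 2 f x)
    (hg : ContDiffAt ℝ 2 g x) :
    deriv (deriv (fun s => f s - g s)) x = deriv (deriv f) x - deriv (deriv g) x := by
  have h := iteratedDeriv_sub (n := 2) hf hg
  simpa [iteratedDeriv_succ, iteratedDeriv_zero, Pi.sub_def] using h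

theorem ContDiffOn.slices {u : ℝ × ℝ → ℝ} {s : Set (ℝ × ℝ)} (hs : IsOpen s)
    (hu : ContDiffOn ℝ 2 u s) {p : ℝ × ℝ} (hp : p ∈ s) :
    ContDiffAt ℝ 2 (fun t => u (t, p.2)) p.1 ∧ ContDiffAt ℝ 2 (fun t => u (p.1, t)) p.2 := by
  have h := hu.contDiffAt (hs.mem_nhds hp)
  exact ⟨h.comp p.1 (f := fun t => (t, p.2)) (by fun_prop),
    h.comp p.2 (f := fun t => (p.1, t)) (by fun_prop)⟩

theorem laplacian2_sub {u v : ℝ × ℝ → ℝ} {s : Set (ℝ × ℝ)} (hs : IsOpen s)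
    (hu : ContDiffOn ℝ 2 u s) (hv : ContDiffOn ℝ 2 v s) {p : ℝ × ℝ} (hp : p ∈ s) :
    laplacian2 (fun q => u q - v q) p = laplacian2 u p - laplacian2 v p := by
  obtain ⟨hu₁, hu₂⟩ := hu.slices hs hp
  obtain ⟨hv₁, hv₂⟩ := hv.slices hs hp
  simp only [laplacian2, deriv_deriv_sub hu₁ hv₁, deriv_deriv_sub hu₂ hv₂]
  ring

theorem laplacian2_nonpos_of_isLocalMax {u : ℝ × ℝ → ℝ} {p : ℝ × ℝ} (h : IsLocalMax u p)
    (hc : ContinuousAt u p) : laplacian2 u p ≤ 0 := by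
  have h₁ : ContinuousAt (fun t : ℝ => (t, p.2)) p.1 := by fun_prop
  have h₂ : ContinuousAt (fun t : ℝ => (p.1, t)) p.2 := by fun_prop
  refine add_nonpos (deriv_deriv_nonpos_of_isLocalMax ?_ (ContinuousAt.comp (g := u) hc h₁))
    (deriv_deriv_nonpos_of_isLocalMax ?_ (ContinuousAt.comp (g := u) hc h₂))
  · exact h₁.eventually h
  · exact h₂.eventually h

/-- Weak maximum principle on a rectangle. -/
theorem nonpos_of_laplacian2_nonneg {a b c d : ℝ} {w : ℝ × ℝ → ℝ}
    (hc : ContinuousOn w (Icc a b ×ˢ Icc c d)) (h2 : ContDiffOn ℝ 2 w (Ioo a b ×ˢ Ioo c d))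
    (hΔ : ∀ p ∈ Ioo a b ×ˢ Ioo c d, 0 ≤ laplacian2 w p)
    (hx : ∀ y ∈ Icc c d, w (a, y) ≤ 0 ∧ w (b, y) ≤ 0)
    (hy : ∀ x ∈ Icc a b, w (x, c) ≤ 0 ∧ w (x, d) ≤ 0) :
    ∀ p ∈ Icc a b ×ˢ Icc c d, w p ≤ 0 := by
  have hs : IsOpen (Ioo a b ×ˢ Ioo c d) := isOpen_Ioo.prod isOpen_Ioo
  set R : ℝ := a ^ 2 + b ^ 2 with hR
  have key : ∀ ε > 0, ∀ p ∈ Icc a b ×ˢ Icc c d, w p - ε * (R - p.1 ^ 2) ≤ 0 := by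
    intro ε hε p hp
    set z : ℝ × ℝ → ℝ := fun q => w q - ε * (R - q.1 ^ 2) with hz
    have hzc : ContinuousOn z (Icc a b ×ˢ Icc c d) := by fun_prop
    obtain ⟨q, hq, hmax⟩ := (isCompact_Icc.prod isCompact_Icc).exists_isMaxOn ⟨p, hp⟩ hzc
    refine (hmax hp).trans ?_
    have hRq : 0 ≤ R - q.1 ^ 2 := by
      have := hq.1.1; have := hq.1.2
      nlinarith [sq_nonneg (a + b - q.1)]
    have hle : w q ≤ 0 → z q ≤ 0 := fun h => by
      have := mul_nonneg hε.le hRq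
      simp only [hz]; linarith
    obtain ⟨x, y⟩ := q
    obtain ⟨⟨hx1, hx2⟩, ⟨hy1, hy2⟩⟩ := hq
    simp only at hx1 hx2 hy1 hy2
    rcases hx1.eq_or_lt with rfl | hx1'
    · exact hle (hx _ ⟨hy1, hy2⟩).1
    rcases hx2.eq_or_lt with rfl | hx2'
    · exact hle (hx _ ⟨hy1, hy2⟩).2
    rcases hy1.eq_or_lt with rfl | hy1'
    · exact hle (hy _ ⟨hx1, hx2⟩).1
    rcases hy2.eq_or_lt with rfl | hy2'
    · exact hle (hy _ ⟨hx1, hx2⟩).2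
    exfalso
    have hmem : (x, y) ∈ Ioo a b ×ˢ Ioo c d := ⟨⟨hx1', hx2'⟩, ⟨hy1', hy2'⟩⟩
    have hnhds : Icc a b ×ˢ Icc c d ∈ nhds (x, y) :=
      Filter.mem_of_superset (hs.mem_nhds hmem)
        (prod_mono Ioo_subset_Icc_self Ioo_subset_Icc_self)
    have h0 := laplacian2_nonpos_of_isLocalMax (hmax.isLocalMax hnhds) (hzc.continuousAt hnhds)
    have h1 : laplacian2 z (x, y) = laplacian2 w (x, y) + 2 * ε := by
      have e1 := laplacian2_sub (v := fun q => ε * (R - q.1 ^ 2)) hs h2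
        (by fun_prop) hmem
      have e2 : laplacian2 (fun q : ℝ × ℝ => ε * (R - q.1 ^ 2)) (x, y) = - 2 * ε := by
        have e3 : deriv (fun s : ℝ => ε * (R - s ^ 2)) = fun s => ε * (-(2 * s)) := by
          funext s; simp
        simp [laplacian2, e3]
        ring
      rw [hz, e1, e2]; ring
    have := hΔ _ hmem
    linarith
  intro p hp
  refine le_of_forall_pos_le_add fun δ hδ => ?_
  have hRp : 0 ≤ R - p.1 ^ 2 := by
    have := hp.1.1; have := hp.1.2
    nlinarith [sq_nonneg (a + b - p.1)]
  have := key (δ / (R - p.1 ^ 2 + 1)) (by positivity) p hp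
  have h3 : δ / (R - p.1 ^ 2 + 1) * (R - p.1 ^ 2) ≤ δ := by
    rw [div_mul_eq_mul_div, div_le_iff₀ (by positivity)]
    nlinarith
  linarith

/-- Comparison with the affine function interpolating the values `A` and `B` on the vertical
sides. -/
theorem le_affine_of_laplacian2_eq_zero {a b c d A B : ℝ} {w : ℝ × ℝ → ℝ} (hA : 0 ≤ A)
    (hB : 0 ≤ B) (hab : a < b)
    (hc : ContinuousOn w (Icc a b ×ˢ Icc c d)) (h2 : ContDiffOn ℝ 2 w (Ioo a b ×ˢ Ioo c d))
    (hΔ : ∀ p ∈ Ioo a b ×ˢ Ioo c d, laplacian2 w p = 0)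
    (hx : ∀ y ∈ Icc c d, w (a, y) ≤ A ∧ w (b, y) ≤ B)
    (hy : ∀ x ∈ Icc a b, w (x, c) ≤ 0 ∧ w (x, d) ≤ 0) :
    ∀ p ∈ Icc a b ×ˢ Icc c d,
      w p ≤ A * ((b - p.1) / (b - a)) + B * ((p.1 - a) / (b - a)) := by
  have hba : 0 < b - a := sub_pos.2 hab
  have hs : IsOpen (Ioo a b ×ˢ Ioo c d) := isOpen_Ioo.prod isOpen_Ioo
  set ℓ : ℝ × ℝ → ℝ := fun p => A * ((b - p.1) / (b - a)) + B * ((p.1 - a) / (b - a)) with hℓ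
  have hℓc : ContDiff ℝ 2 ℓ := by fun_prop
  have hℓΔ : ∀ p, laplacian2 ℓ p = 0 := by
    intro p
    have e : ∀ t : ℝ, HasDerivAt (fun s => A * ((b - s) / (b - a)) + B * ((s - a) / (b - a)))
        (A * (-1 / (b - a)) + B * (1 / (b - a))) t := fun t =>
      ((((hasDerivAt_id t).const_sub b).div_const _).const_mul A).add
        ((((hasDerivAt_id t).sub_const a).div_const _).const_mul B)
    have e' : deriv (fun s => A * ((b - s) / (b - a)) + B * ((s - a) / (b - a))) =
        fun _ => A * (-1 / (b - a)) + B * (1 / (b - a)) := funext fun t => (e t).deriv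
    simp [laplacian2, hℓ, e']
  have hpos : ∀ x ∈ Icc a b, ∀ y, 0 ≤ ℓ (x, y) := fun x hx y =>
    add_nonneg (mul_nonneg hA (div_nonneg (sub_nonneg.2 hx.2) hba.le))
      (mul_nonneg hB (div_nonneg (sub_nonneg.2 hx.1) hba.le))
  intro p hp
  have := nonpos_of_laplacian2_nonneg (w := fun q => w q - ℓ q)
    (hc.sub hℓc.continuous.continuousOn) (h2.sub hℓc.contDiffOn)
    (fun p hp => by
      rw [laplacian2_sub hs h2 hℓc.contDiffOn hp, hΔ p hp, hℓΔ, sub_zero])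
    (fun y hy => by
      have := hx y hy
      simp only [hℓ, sub_self, zero_div, mul_zero, add_zero, zero_add, div_self hba.ne', mul_one]
      constructor <;> linarith)
    (fun x hx => by
      have h1 := hy x hx
      exact ⟨by linarith [hpos x hx c], by linarith [hpos x hx d]⟩) p hp
  simpa using this

theorem IsRegSolPoisson.le {ξm ξ0 ξp γm γp : ℝ}
    (hξm0 : 0 < ξm) (hξm : ξm < ξ0) (hξp : ξ0 < ξp) (hξp1 : ξp < 1)
    (hγm : 0 < γm) (hγp : 0 < γp) (hsum : γm + γp ≤ 1)
    {fm fp : ℝ × ℝ → ℝ} {φ0 : ℝ → ℝ} {u v : ℝ × ℝ → ℝ}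
    (hu : IsRegSolPoisson ξm ξ0 ξp γm γp fm fp φ0 u)
    (hv : IsRegSolPoisson ξm ξ0 ξp γm γp fm fp φ0 v) :
    ∀ p ∈ Icc (0 : ℝ) 1 ×ˢ Icc (0 : ℝ) 1, v p ≤ u p := by
  obtain ⟨huc, hum, hup, huΔm, huΔp, huy, hux, huξ⟩ := hu
  obtain ⟨hvc, hvm, hvp, hvΔm, hvΔp, hvy, hvx, hvξ⟩ := hv
  have hξ0 : 0 < ξ0 := hξm0.trans hξm
  have hξ1 : ξ0 < 1 := hξp.trans hξp1
  set w : ℝ × ℝ → ℝ := fun q => v q - u q with hw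
  have hc : ContinuousOn w (Icc 0 1 ×ˢ Icc 0 1) := hvc.sub huc
  have hsub : ∀ y ∈ Icc (0 : ℝ) 1, (ξ0, y) ∈ Icc (0 : ℝ) 1 ×ˢ Icc (0 : ℝ) 1 :=
    fun y hy => ⟨⟨hξ0.le, hξ1.le⟩, hy⟩
  have hline : ContinuousOn (fun y => w (ξ0, y)) (Icc 0 1) :=
    hc.comp (f := fun y : ℝ => (ξ0, y)) (by fun_prop) hsub
  obtain ⟨y0, hy0, hmax⟩ := isCompact_Icc.exists_isMaxOn
    (nonempty_Icc.2 (zero_le_one' ℝ)) hline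
  set A := max (w (ξ0, y0)) 0 with hA
  have hA0 : 0 ≤ A := le_max_right _ _
  have hwA : ∀ y ∈ Icc (0 : ℝ) 1, w (ξ0, y) ≤ A := fun y hy => (hmax hy).trans (le_max_left _ _)
  have hwx : ∀ y ∈ Icc (0 : ℝ) 1, w (0, y) = 0 ∧ w (1, y) = 0 := fun y hy => by
    simp [hw, hux y hy, hvx y hy]
  have hwy : ∀ x ∈ Icc (0 : ℝ) 1, w (x, 0) = 0 ∧ w (x, 1) = 0 := fun x hx => by
    simp [hw, huy x hx, hvy x hx]
  have hL : ∀ p ∈ Icc 0 ξ0 ×ˢ Icc (0 : ℝ) 1, w p ≤ A * (p.1 / ξ0) := by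
    have := le_affine_of_laplacian2_eq_zero (w := w) le_rfl hA0 hξ0
      (hc.mono (prod_mono (Icc_subset_Icc_right hξ1.le) Subset.rfl)) (hvm.sub hum)
      (fun p hp => by
        rw [hw, laplacian2_sub (isOpen_Ioo.prod isOpen_Ioo) hvm hum hp, hvΔm p hp, huΔm p hp,
          sub_self])
      (fun y hy => ⟨(hwx y hy).1.le, hwA y hy⟩)
      (fun x hx => by
        have := hwy x ⟨hx.1, hx.2.trans hξ1.le⟩
        exact ⟨this.1.le, this.2.le⟩)
    simpa using this
  have hR : ∀ p ∈ Icc ξ0 1 ×ˢ Icc (0 : ℝ) 1, w p ≤ A * ((1 - p.1) / (1 - ξ0)) := by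
    have := le_affine_of_laplacian2_eq_zero (w := w) hA0 le_rfl hξ1
      (hc.mono (prod_mono (Icc_subset_Icc_left hξ0.le) Subset.rfl)) (hvp.sub hup)
      (fun p hp => by
        rw [hw, laplacian2_sub (isOpen_Ioo.prod isOpen_Ioo) hvp hup hp, hvΔp p hp, huΔp p hp,
          sub_self])
      (fun y hy => ⟨hwA y hy, (hwx y hy).2.le⟩)
      (fun x hx => by
        have := hwy x ⟨hξ0.le.trans hx.1, hx.2⟩
        exact ⟨this.1.le, this.2.le⟩)
    simpa using this
  have hAz : A = 0 := by
    rcases le_or_gt (w (ξ0, y0)) 0 with h | h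
    · exact max_eq_right h
    · have hAe : A = w (ξ0, y0) := max_eq_left h.le
      have hAp : 0 < A := hAe ▸ h
      have e : w (ξ0, y0) = γm * w (ξm, y0) + γp * w (ξp, y0) := by
        simp only [hw]
        rw [huξ y0 hy0, hvξ y0 hy0]; ring
      have h1 := hL (ξm, y0) ⟨⟨hξm0.le, hξm.le⟩, hy0⟩
      have h2 := hR (ξp, y0) ⟨⟨hξp.le, hξp1.le⟩, hy0⟩
      have h3 : ξm / ξ0 < 1 := (div_lt_one hξ0).2 hξm
      have h4 : (1 - ξp) / (1 - ξ0) < 1 := (div_lt_one (by linarith)).2 (by linarith)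
      have h5 : w (ξm, y0) < A := h1.trans_lt (by simpa using mul_lt_mul_of_pos_left h3 hAp)
      have h6 : w (ξp, y0) < A := h2.trans_lt (by simpa using mul_lt_mul_of_pos_left h4 hAp)
      nlinarith
  intro p hp
  have : w p ≤ 0 := by
    rcases le_total p.1 ξ0 with h | h
    · simpa [hAz] using hL p ⟨⟨hp.1.1, h⟩, hp.2⟩
    · simpa [hAz] using hR p ⟨⟨h, hp.1.2⟩, hp.2⟩
  simpa [hw] using this

/-- The square roots of the Dirichlet eigenvalues of `-d²/dy²` on the unit interval. -/
noncomputable def sineFreq (n : ℕ) : ℝ := (n + 1) * Real.pi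

theorem one_le_sineFreq (n : ℕ) : 1 ≤ sineFreq n := by
  have h1 : (1 : ℝ) ≤ n + 1 := by
    have : (0 : ℝ) ≤ n := n.cast_nonneg
    linarith
  have h2 : 1 ≤ Real.pi := by linarith [Real.pi_gt_three]
  exact one_le_mul_of_one_le_of_one_le h1 h2

theorem sineFreq_pos (n : ℕ) : 0 < sineFreq n := zero_lt_one.trans_le (one_le_sineFreq n)

theorem summable_div_sineFreq_sq (C : ℝ) : Summable fun n => C / sineFreq n ^ 2 := by
  have h := (summable_nat_add_iff 1).2 (Real.summable_one_div_nat_pow.2 one_lt_two)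
  refine (h.mul_left (C / Real.pi ^ 2)).congr fun n => ?_
  simp only [sineFreq]
  push_cast
  field_simp

theorem HasSum.of_eq {f g : ℕ → ℝ} {a b : ℝ} (h : HasSum f a) (hfg : ∀ n, g n = f n)
    (hab : b = a) : HasSum g b := by
  rwa [hab, funext hfg]

theorem hasSum_green {y s : ℝ} (hy : y ∈ Icc (0 : ℝ) 1) (hs : s ∈ Icc (0 : ℝ) 1) :
    HasSum (fun n => 2 / sineFreq n ^ 2 * (Real.sin (sineFreq n * y) * Real.sin (sineFreq n * s)))
      (min y s - y * s) := by
  have habs : |y - s| ≤ 1 := abs_le.2 ⟨by linarith [hy.1, hs.2], by linarith [hy.2, hs.1]⟩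
  have h1 := hasSum_one_div_nat_pow_mul_cos one_ne_zero (x := |y - s| / 2)
    ⟨by positivity, by linarith⟩
  have h2 := hasSum_one_div_nat_pow_mul_cos one_ne_zero (x := (y + s) / 2)
    ⟨by linarith [hy.1, hs.1], by linarith [hy.2, hs.2]⟩
  have hB : ∀ x : ℝ, Polynomial.eval x (Polynomial.map (algebraMap ℚ ℝ)
      (Polynomial.bernoulli (2 * 1))) = x ^ 2 - x + 1 / 6 := by
    intro x
    have hb : bernoulli 2 = 1 / 6 := by
      rw [bernoulli_eq_bernoulli'_of_ne_one (by norm_num), bernoulli'_two]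
    simp [Polynomial.bernoulli, Finset.sum_range_succ, hb, bernoulli_one,
      Polynomial.map_monomial, Polynomial.eval_monomial]
    ring
  have h3 := (hasSum_nat_add_iff' 1).2 ((h1.sub h2).mul_left (1 / Real.pi ^ 2))
  refine h3.of_eq (fun n => ?_) ?_
  · have hc : Real.cos (2 * Real.pi * ((n + 1 : ℕ) : ℝ) * (|y - s| / 2)) =
        Real.cos (sineFreq n * y - sineFreq n * s) := by
      rw [← Real.cos_abs (sineFreq n * y - sineFreq n * s), ← mul_sub, abs_mul,
        abs_of_pos (sineFreq_pos n), sineFreq]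
      push_cast
      congr 1; ring
    have hc' : Real.cos (2 * Real.pi * ((n + 1 : ℕ) : ℝ) * ((y + s) / 2)) =
        Real.cos (sineFreq n * y + sineFreq n * s) := by
      rw [sineFreq]
      push_cast
      congr 1; ring
    rw [hc, hc', Real.cos_sub, Real.cos_add, sineFreq]
    push_cast
    field_simp
    ring
  · have hmin : min y s = (y + s - |y - s|) / 2 := by
      rcases le_total y s with h | h
      · rw [min_eq_left h, abs_of_nonpos (by linarith)]; ring
      · rw [min_eq_right h, abs_of_nonneg (by linarith)]; ring
    rw [hB, hB, hmin]
    have : |y - s| ^ 2 = (y - s) ^ 2 := sq_abs _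
    simp [Nat.factorial]
    field_simp
    nlinarith

theorem integral_green {g g' g'' : ℝ → ℝ} (hg : ∀ t, HasDerivAt g (g' t) t)
    (hg' : ∀ t, HasDerivAt g' (g'' t) t) (hc : Continuous g'') (h0 : g 0 = 0) (h1 : g 1 = 0)
    {y : ℝ} (hy : y ∈ Icc (0 : ℝ) 1) :
    ∫ s in (0 : ℝ)..1, (min y s - y * s) * g'' s = - g y := by
  have hi : ∀ a b, IntervalIntegrable (fun s => (min y s - y * s) * g'' s)
      MeasureTheory.volume a b := fun a b => by
    apply Continuous.intervalIntegrable; fun_prop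
  rw [← intervalIntegral.integral_add_adjacent_intervals (hi 0 y) (hi y 1)]
  have e1 : ∫ s in (0 : ℝ)..y, (min y s - y * s) * g'' s = (1 - y) * (y * g' y - g y) := by
    have : ∫ s in (0 : ℝ)..y, (min y s - y * s) * g'' s = ∫ s in (0 : ℝ)..y,
        (1 - y) * (s * g'' s) := by
      refine intervalIntegral.integral_congr fun s hs => ?_
      rw [uIcc_of_le hy.1] at hs
      simp only [min_eq_right hs.2]; ring
    rw [this, intervalIntegral.integral_eq_sub_of_hasDerivAt
      (f := fun s => (1 - y) * (s * g' s - g s))]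
    · simp [h0]
    · intro t _
      exact ((((hasDerivAt_id t).mul (hg' t)).sub (hg t)).const_mul (1 - y)).congr_deriv
        (by simp only [id]; ring)
    · apply Continuous.intervalIntegrable; fun_prop
  have e2 : ∫ s in y..1, (min y s - y * s) * g'' s = - (y * ((1 - y) * g' y + g y)) := by
    have : ∫ s in y..1, (min y s - y * s) * g'' s = ∫ s in y..1, y * ((1 - s) * g'' s) := by
      refine intervalIntegral.integral_congr fun s hs => ?_
      rw [uIcc_of_le hy.2] at hs
      simp only [min_eq_left hs.1]; ring
    rw [this, intervalIntegral.integral_eq_sub_of_hasDerivAt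
      (f := fun s => y * ((1 - s) * g' s + g s))]
    · simp [h1]
    · intro t _
      exact (((((hasDerivAt_id t).const_sub 1).mul (hg' t)).add (hg t)).const_mul y).congr_deriv
        (by simp only [id]; ring)
    · apply Continuous.intervalIntegrable; fun_prop
  rw [e1, e2]; ring

theorem exists_sine_expansion {F : ℝ × ℝ → ℝ} (hF : ContDiff ℝ 2 F)
    (hF0 : ∀ x, F (x, 0) = 0 ∧ F (x, 1) = 0) :
    ∃ (a : ℕ → ℝ → ℝ) (C : ℝ), 0 ≤ C ∧ (∀ n, Continuous (a n)) ∧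
      (∀ n, ∀ x ∈ Icc (0 : ℝ) 1, |a n x| ≤ C / sineFreq n ^ 2) ∧
      ∀ x ∈ Icc (0 : ℝ) 1, ∀ y ∈ Icc (0 : ℝ) 1,
        HasSum (fun n => a n x * Real.sin (sineFreq n * y)) (F (x, y)) := by
  set G : ℝ × ℝ → ℝ := fun p => fderiv ℝ F p (0, 1) with hG
  set H : ℝ × ℝ → ℝ := fun p => fderiv ℝ G p (0, 1) with hH
  have hGc : ContDiff ℝ 1 G :=
    (hF.fderiv_right (m := 1) (by norm_num)).clm_apply contDiff_const
  have hHc : Continuous H :=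
    ((hGc.fderiv_right (m := 0) (by norm_num)).clm_apply contDiff_const).continuous
  have hder : ∀ {E : ℝ × ℝ → ℝ}, Differentiable ℝ E → ∀ x t : ℝ,
      HasDerivAt (fun s => E (x, s)) (fderiv ℝ E (x, t) (0, 1)) t := fun hE x t =>
    (hE (x, t)).hasFDerivAt.comp_hasDerivAt t ((hasDerivAt_const t x).prodMk (hasDerivAt_id t))
  have hFG : ∀ x t : ℝ, HasDerivAt (fun s => F (x, s)) (G (x, t)) t :=
    hder (hF.differentiable (by norm_num))
  have hGH : ∀ x t : ℝ, HasDerivAt (fun s => G (x, s)) (H (x, t)) t :=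
    hder (hGc.differentiable (by norm_num))
  obtain ⟨M, hM⟩ := (isCompact_Icc.prod isCompact_Icc :
    IsCompact (Icc (0 : ℝ) 1 ×ˢ Icc (0 : ℝ) 1)).exists_bound_of_continuousOn hHc.continuousOn
  have hM0 : 0 ≤ M := (norm_nonneg _).trans (hM (0, 0) (by simp))
  have hsin : ∀ t, |Real.sin t| ≤ 1 := Real.abs_sin_le_one
  refine ⟨fun n x => -(2 / sineFreq n ^ 2 * ∫ s in (0 : ℝ)..1, Real.sin (sineFreq n * s) *
    H (x, s)), 2 * M, by positivity, fun n => ?_, fun n x hx => ?_, fun x hx y hy => ?_⟩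
  · refine (continuous_const.mul ?_).neg
    refine intervalIntegral.continuous_parametric_intervalIntegral_of_continuous
      (f := fun x s => Real.sin (sineFreq n * s) * H (x, s)) (s := fun _ => 1) ?_ continuous_const
    simp only [Function.uncurry_def]
    fun_prop
  · have hb : |∫ s in (0 : ℝ)..1, Real.sin (sineFreq n * s) * H (x, s)| ≤ M := by
      have := intervalIntegral.norm_integral_le_of_norm_le_const (a := 0) (b := 1) (C := M)
        (f := fun s => Real.sin (sineFreq n * s) * H (x, s)) (fun s hs => by
          rw [uIoc_of_le zero_le_one] at hs
          rw [norm_mul, ← one_mul M]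
          exact mul_le_mul (hsin _) (hM (x, s) ⟨hx, hs.1.le, hs.2⟩) (norm_nonneg _) zero_le_one)
      simpa using this
    have h2 : 0 ≤ 2 / sineFreq n ^ 2 := by positivity
    rw [abs_neg, abs_mul, abs_of_nonneg h2, mul_div_right_comm]
    exact mul_le_mul_of_nonneg_left hb h2
  · have key : HasSum (fun n => ∫ s in (0 : ℝ)..1, 2 / sineFreq n ^ 2 *
        (Real.sin (sineFreq n * y) * Real.sin (sineFreq n * s)) * H (x, s))
        (∫ s in (0 : ℝ)..1, (min y s - y * s) * H (x, s)) := by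
      refine intervalIntegral.hasSum_integral_of_dominated_convergence
        (fun n _ => (2 * M) / sineFreq n ^ 2) (fun n => ?_) (fun n => ?_) ?_ (by simp) ?_
      · apply Continuous.aestronglyMeasurable; fun_prop
      · refine Filter.Eventually.of_forall fun s hs => ?_
        rw [uIoc_of_le zero_le_one] at hs
        have h2 : 0 ≤ 2 / sineFreq n ^ 2 := by positivity
        have h3 := hM (x, s) ⟨hx, hs.1.le, hs.2⟩
        have h4 := mul_le_one₀ (hsin (sineFreq n * y)) (abs_nonneg _) (hsin (sineFreq n * s))
        rw [norm_mul, norm_mul, norm_mul, Real.norm_of_nonneg h2, mul_div_right_comm]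
        exact mul_le_mul (mul_le_of_le_one_right h2 h4) h3 (norm_nonneg _) h2
      · exact Filter.Eventually.of_forall fun s _ => summable_div_sineFreq_sq _
      · refine Filter.Eventually.of_forall fun s hs => ?_
        rw [uIoc_of_le zero_le_one] at hs
        exact (hasSum_green hy ⟨hs.1.le, hs.2⟩).mul_right _
    rw [integral_green (hFG x) (hGH x) (by fun_prop) (hF0 x).1 (hF0 x).2 hy] at key
    refine key.neg.of_eq (fun n => ?_) (by simp)
    · simp only [mul_assoc, intervalIntegral.integral_const_mul]
      ring

/-- The equation `w'' = k² w + g` has a solution whose size on `[0, 1]` is controlled by `g`. -/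
theorem exists_particular_solution {g : ℝ → ℝ} (hg : Continuous g) {k M : ℝ} (hk : 0 < k)
    (hM : ∀ x ∈ Icc (0 : ℝ) 1, |g x| ≤ M) :
    ∃ p q : ℝ → ℝ, (∀ x, HasDerivAt p (q x) x) ∧ (∀ x, HasDerivAt q (k ^ 2 * p x + g x) x) ∧
      ∀ x ∈ Icc (0 : ℝ) 1, |p x| ≤ M / k ^ 2 ∧ |q x| ≤ M / k := by
  have hM0 : 0 ≤ M := (abs_nonneg _).trans (hM 0 (by simp))
  set I : ℝ → ℝ := fun x => ∫ s in (0 : ℝ)..x, Real.exp (k * s) * g s with hI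
  set J : ℝ → ℝ := fun x => ∫ s in (1 : ℝ)..x, Real.exp (-(k * s)) * g s with hJ
  have hIc : Continuous fun s => Real.exp (k * s) * g s := by fun_prop
  have hJc : Continuous fun s => Real.exp (-(k * s)) * g s := by fun_prop
  have hI' : ∀ x, HasDerivAt I (Real.exp (k * x) * g x) x := fun x =>
    intervalIntegral.integral_hasDerivAt_right (hIc.intervalIntegrable _ _)
      (hIc.stronglyMeasurableAtFilter _ _) hIc.continuousAt
  have hJ' : ∀ x, HasDerivAt J (Real.exp (-(k * x)) * g x) x := fun x =>
    intervalIntegral.integral_hasDerivAt_right (hJc.intervalIntegrable _ _)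
      (hJc.stronglyMeasurableAtFilter _ _) hJc.continuousAt
  have hE : ∀ x, HasDerivAt (fun s => Real.exp (k * s)) (k * Real.exp (k * x)) x := fun x =>
    (((hasDerivAt_id x).const_mul k).exp).congr_deriv (by simp only [id]; ring)
  have hE' : ∀ x, HasDerivAt (fun s => Real.exp (-(k * s))) (-k * Real.exp (-(k * x))) x :=
    fun x => (((hasDerivAt_id x).const_mul k).neg.exp).congr_deriv (by
      simp only [id, Pi.neg_apply]; ring)
  have hEE : ∀ x, Real.exp (-(k * x)) * Real.exp (k * x) = 1 := fun x => by
    rw [← Real.exp_add]; simp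
  have hIb : ∀ x ∈ Icc (0 : ℝ) 1, Real.exp (-(k * x)) * |I x| ≤ M / k := by
    intro x hx
    have h1 : |I x| ≤ ∫ s in (0 : ℝ)..x, M * Real.exp (k * s) := by
      refine intervalIntegral.norm_integral_le_of_norm_le
        (f := fun s => Real.exp (k * s) * g s) (g := fun s => M * Real.exp (k * s)) hx.1
        (Filter.Eventually.of_forall fun s hs => ?_)
        (by apply Continuous.intervalIntegrable; fun_prop)
      rw [norm_mul, Real.norm_of_nonneg (Real.exp_pos _).le, mul_comm]
      exact mul_le_mul_of_nonneg_right (hM s ⟨hs.1.le, hs.2.trans hx.2⟩) (Real.exp_pos _).le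
    rw [intervalIntegral.integral_eq_sub_of_hasDerivAt (f := fun s => M / k * Real.exp (k * s))
      (fun t _ => ((hE t).const_mul (M / k)).congr_deriv (by field_simp))
      (by apply Continuous.intervalIntegrable; fun_prop)] at h1
    have h2 : |I x| ≤ M / k * Real.exp (k * x) := h1.trans (by simp; positivity)
    calc _ ≤ Real.exp (-(k * x)) * (M / k * Real.exp (k * x)) := by gcongr
      _ = M / k * (Real.exp (-(k * x)) * Real.exp (k * x)) := by ring
      _ = M / k := by rw [hEE, mul_one]
  have hJb : ∀ x ∈ Icc (0 : ℝ) 1, Real.exp (k * x) * |J x| ≤ M / k := by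
    intro x hx
    have h1 : |J x| ≤ ∫ s in x..(1 : ℝ), M * Real.exp (-(k * s)) := by
      rw [hJ]
      simp only
      rw [intervalIntegral.integral_symm, abs_neg]
      refine intervalIntegral.norm_integral_le_of_norm_le
        (f := fun s => Real.exp (-(k * s)) * g s) (g := fun s => M * Real.exp (-(k * s))) hx.2
        (Filter.Eventually.of_forall fun s hs => ?_)
        (by apply Continuous.intervalIntegrable; fun_prop)
      rw [norm_mul, Real.norm_of_nonneg (Real.exp_pos _).le, mul_comm]
      exact mul_le_mul_of_nonneg_right (hM s ⟨hx.1.trans hs.1.le, hs.2⟩) (Real.exp_pos _).le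
    rw [intervalIntegral.integral_eq_sub_of_hasDerivAt
      (f := fun s => -(M / k) * Real.exp (-(k * s)))
      (fun t _ => ((hE' t).const_mul (-(M / k))).congr_deriv (by field_simp))
      (by apply Continuous.intervalIntegrable; fun_prop)] at h1
    have h2 : |J x| ≤ M / k * Real.exp (-(k * x)) := h1.trans (by simp; positivity)
    calc _ ≤ Real.exp (k * x) * (M / k * Real.exp (-(k * x))) := by gcongr
      _ = M / k * (Real.exp (-(k * x)) * Real.exp (k * x)) := by ring
      _ = M / k := by rw [hEE, mul_one]
  refine ⟨fun x => -(1 / (2 * k)) * (Real.exp (-(k * x)) * I x - Real.exp (k * x) * J x),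
    fun x => 1 / 2 * (Real.exp (-(k * x)) * I x + Real.exp (k * x) * J x),
    fun x => ?_, fun x => ?_, fun x hx => ?_⟩
  · refine ((((hE' x).mul (hI' x)).sub ((hE x).mul (hJ' x))).const_mul _).congr_deriv ?_
    field_simp
    ring
  · refine ((((hE' x).mul (hI' x)).add ((hE x).mul (hJ' x))).const_mul _).congr_deriv ?_
    field_simp
    linear_combination 2 * g x * hEE x
  · have h1 : |Real.exp (-(k * x)) * I x| ≤ M / k := by
      rw [abs_mul, abs_of_pos (Real.exp_pos _)]; exact hIb x hx
    have h2 : |Real.exp (k * x) * J x| ≤ M / k := by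
      rw [abs_mul, abs_of_pos (Real.exp_pos _)]; exact hJb x hx
    constructor
    · rw [abs_mul, abs_neg, abs_of_pos (by positivity)]
      calc _ ≤ 1 / (2 * k) * (M / k + M / k) := by
            gcongr; exact (abs_sub _ _).trans (add_le_add h1 h2)
        _ = M / k ^ 2 := by field_simp; ring
    · rw [abs_mul, abs_of_pos (by positivity)]
      calc _ ≤ 1 / 2 * (M / k + M / k) := by
            gcongr; exact (abs_add_le _ _).trans (add_le_add h1 h2)
        _ = M / k := by ring

theorem Real.sinh_le_exp_sub_mul_sinh {a b : ℝ} (h : a ≤ b) :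
    Real.sinh a ≤ Real.exp (-(b - a)) * Real.sinh b := by
  have h1 : Real.exp (-(b - a)) * Real.exp b = Real.exp a := by rw [← Real.exp_add]; ring_nf
  have h2 : Real.exp (-(b - a)) * Real.exp (-b) ≤ Real.exp (-a) := by
    rw [← Real.exp_add]; exact Real.exp_le_exp.2 (by linarith)
  rw [Real.sinh_eq, Real.sinh_eq]
  linarith

theorem sinh_div_sinh_le_one {k L x : ℝ} (hk : 0 < k) (hL : 0 < L) (hx : x ∈ Icc 0 L) :
    |Real.sinh (k * x) / Real.sinh (k * L)| ≤ 1 := by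
  have hs : 0 < Real.sinh (k * L) := Real.sinh_pos_iff.2 (by positivity)
  have hs' : 0 ≤ Real.sinh (k * x) := Real.sinh_nonneg_iff.2 (mul_nonneg hk.le hx.1)
  rw [abs_of_nonneg (by positivity), div_le_one hs]
  exact Real.sinh_le_sinh.2 (by nlinarith [hx.2])

/-- Exponential decay of the homogeneous solutions away from the end point `L`. -/
theorem exists_cosh_div_sinh_le {L δ : ℝ} (hL : 0 < L) (hδ : 0 < δ) :
    ∃ D, 0 ≤ D ∧ ∀ k ≥ 1, ∀ x, 0 ≤ x → x ≤ L - δ →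
      |Real.cosh (k * x) / Real.sinh (k * L)| ≤ D / k ^ 2 ∧
      |Real.sinh (k * x) / Real.sinh (k * L)| ≤ D / k ^ 2 := by
  have hc : 0 < 1 - Real.exp (-(2 * L)) := by
    rw [sub_pos, Real.exp_lt_one_iff]; linarith
  refine ⟨2 / (1 - Real.exp (-(2 * L))) * (2 / δ ^ 2), by positivity, fun k hk x hx hxδ => ?_⟩
  have hk0 : 0 < k := zero_lt_one.trans_le hk
  have hs : 0 < Real.sinh (k * L) := Real.sinh_pos_iff.2 (by positivity)
  have hs' : 0 ≤ Real.sinh (k * x) := Real.sinh_nonneg_iff.2 (by positivity)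
  have hcp : 0 < Real.cosh (k * x) := Real.cosh_pos _
  have hsc : Real.sinh (k * x) ≤ Real.cosh (k * x) := (Real.sinh_lt_cosh _).le
  have key : Real.cosh (k * x) / Real.sinh (k * L) ≤
      2 / (1 - Real.exp (-(2 * L))) * (2 / δ ^ 2) / k ^ 2 := by
    have h1 : Real.cosh (k * x) ≤ Real.exp (k * (L - δ)) := by
      have e1 : Real.exp (k * x) ≤ Real.exp (k * (L - δ)) := Real.exp_le_exp.2 (by gcongr)
      have e2 : Real.exp (-(k * x)) ≤ Real.exp (k * x) :=
        Real.exp_le_exp.2 (by nlinarith [mul_nonneg hk0.le hx])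
      rw [Real.cosh_eq]; linarith
    have h2 : Real.exp (k * L) * (1 - Real.exp (-(2 * L))) / 2 ≤ Real.sinh (k * L) := by
      have e1 : Real.exp (-(k * L)) ≤ Real.exp (k * L) * Real.exp (-(2 * L)) := by
        rw [← Real.exp_add]; exact Real.exp_le_exp.2 (by nlinarith)
      rw [Real.sinh_eq]; linarith
    have h3 : Real.exp (k * (L - δ)) * (k * δ) ^ 2 ≤ 2 * Real.exp (k * L) := by
      have e1 := Real.pow_div_factorial_le_exp (k * δ) (by positivity) 2
      have e2 : Real.exp (k * L) = Real.exp (k * (L - δ)) * Real.exp (k * δ) := by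
        rw [← Real.exp_add]; ring_nf
      rw [e2]
      simp only [Nat.factorial] at e1
      norm_num at e1
      nlinarith [Real.exp_pos (k * (L - δ))]
    rw [div_le_iff₀ hs]
    calc _ ≤ Real.exp (k * (L - δ)) := h1
      _ ≤ 2 * Real.exp (k * L) / (k * δ) ^ 2 := by rwa [le_div_iff₀ (by positivity)]
      _ = 2 / (1 - Real.exp (-(2 * L))) * (2 / δ ^ 2) / k ^ 2 *
        (Real.exp (k * L) * (1 - Real.exp (-(2 * L))) / 2) := by field_simp
      _ ≤ _ := by gcongr
  rw [abs_of_nonneg (by positivity), abs_of_nonneg (by positivity)]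
  exact ⟨key, le_trans (by gcongr) key⟩

/-- Termwise differentiation of a series of products `∑ a n x * b n y`. -/
theorem hasFDerivAt_tsum_mul {a a' b b' : ℕ → ℝ → ℝ} {c d : ℝ} {v : ℕ → ℝ} (hv : Summable v)
    (ha : ∀ n, ∀ x ∈ Ioo c d, HasDerivAt (a n) (a' n x) x)
    (hb : ∀ n y, HasDerivAt (b n) (b' n y) y)
    (h0 : ∀ n, ∀ x ∈ Ioo c d, ∀ y, |a n x * b n y| ≤ v n)
    (h1 : ∀ n, ∀ x ∈ Ioo c d, ∀ y, |a' n x * b n y| ≤ v n)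
    (h2 : ∀ n, ∀ x ∈ Ioo c d, ∀ y, |a n x * b' n y| ≤ v n)
    {p : ℝ × ℝ} (hp : p ∈ Ioo c d ×ˢ (univ : Set ℝ)) :
    HasFDerivAt (fun p : ℝ × ℝ => ∑' n, a n p.1 * b n p.2)
      ((∑' n, a' n p.1 * b n p.2) • ContinuousLinearMap.fst ℝ ℝ ℝ +
        (∑' n, a n p.1 * b' n p.2) • ContinuousLinearMap.snd ℝ ℝ ℝ) p := by
  have key := hasFDerivAt_tsum_of_isPreconnected (𝕜 := ℝ) (u := fun n => v n + v n)
    (f := fun n (p : ℝ × ℝ) => a n p.1 * b n p.2)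
    (f' := fun n p => (a' n p.1 * b n p.2) • ContinuousLinearMap.fst ℝ ℝ ℝ +
        (a n p.1 * b' n p.2) • ContinuousLinearMap.snd ℝ ℝ ℝ)
    (s := Ioo c d ×ˢ univ) (hv.add hv) (isOpen_Ioo.prod isOpen_univ)
    (isPreconnected_Ioo.prod isPreconnected_univ)
    (fun n q hq => by
      have e1 := (ha n q.1 hq.1).comp_hasFDerivAt q (hasFDerivAt_fst (𝕜 := ℝ) (p := q))
      have e2 := (hb n q.2).comp_hasFDerivAt q (hasFDerivAt_snd (𝕜 := ℝ) (p := q))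
      refine (e1.mul e2).congr_fderiv ?_
      ext <;> simp [mul_comm])
    (fun n q hq => by
      refine (norm_add_le _ _).trans (add_le_add ?_ ?_)
      · rw [norm_smul]
        exact (mul_le_of_le_one_right (norm_nonneg _)
          (ContinuousLinearMap.norm_fst_le ℝ ℝ ℝ)).trans (h1 n q.1 hq.1 q.2)
      · rw [norm_smul]
        exact (mul_le_of_le_one_right (norm_nonneg _)
          (ContinuousLinearMap.norm_snd_le ℝ ℝ ℝ)).trans (h2 n q.1 hq.1 q.2))
    hp (hv.of_norm_bounded (fun n => h0 n p.1 hp.1 p.2)) hp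
  refine key.congr_fderiv ?_
  have s1 : Summable fun n => a' n p.1 * b n p.2 :=
    hv.of_norm_bounded (fun n => h1 n p.1 hp.1 p.2)
  have s2 : Summable fun n => a n p.1 * b' n p.2 :=
    hv.of_norm_bounded (fun n => h2 n p.1 hp.1 p.2)
  rw [← s1.tsum_smul_const, ← s2.tsum_smul_const, ← (s1.smul_const _).tsum_add (s2.smul_const _)]

theorem contDiffOn_succ_of_hasFDerivAt_fst_snd {m : ℕ} {U Ux Uy : ℝ × ℝ → ℝ}
    {s : Set (ℝ × ℝ)} (hs : IsOpen s)
    (hU : ∀ p ∈ s, HasFDerivAt U (Ux p • ContinuousLinearMap.fst ℝ ℝ ℝ +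
      Uy p • ContinuousLinearMap.snd ℝ ℝ ℝ) p)
    (hx : ContDiffOn ℝ m Ux s) (hy : ContDiffOn ℝ m Uy s) : ContDiffOn ℝ (m + 1) U s := by
  rw [contDiffOn_succ_iff_fderiv_of_isOpen hs]
  refine ⟨fun p hp => (hU p hp).differentiableAt.differentiableWithinAt, by simp, ?_⟩
  refine ((hx.smul (contDiffOn_const (c := ContinuousLinearMap.fst ℝ ℝ ℝ))).add
    (hy.smul (contDiffOn_const (c := ContinuousLinearMap.snd ℝ ℝ ℝ)))).congr fun p hp => ?_
  rw [(hU p hp).fderiv]; rfl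

theorem HasFDerivAt.hasDerivAt_slices {U : ℝ × ℝ → ℝ} {A B : ℝ} {p : ℝ × ℝ}
    (h : HasFDerivAt U (A • ContinuousLinearMap.fst ℝ ℝ ℝ +
      B • ContinuousLinearMap.snd ℝ ℝ ℝ) p) :
    HasDerivAt (fun t => U (t, p.2)) A p.1 ∧ HasDerivAt (fun t => U (p.1, t)) B p.2 := by
  constructor
  · have := HasFDerivAt.comp_hasDerivAt (f := fun t => (t, p.2)) p.1 h
      ((hasDerivAt_id p.1).prodMk (hasDerivAt_const p.1 p.2))
    exact this.congr_deriv (by simp)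
  · have := HasFDerivAt.comp_hasDerivAt (f := fun t => (p.1, t)) p.2 h
      ((hasDerivAt_const p.2 p.1).prodMk (hasDerivAt_id p.2))
    exact this.congr_deriv (by simp)

/-- Regularity of a sine series whose coefficients solve `w'' = k² w + g`, with locally summable
bounds. -/
theorem sineSeries_regular {w w' g : ℕ → ℝ → ℝ} {c d C : ℝ}
    (hw : ∀ n, ∀ x ∈ Ioo c d, HasDerivAt (w n) (w' n x) x)
    (hw' : ∀ n, ∀ x ∈ Ioo c d, HasDerivAt (w' n) (sineFreq n ^ 2 * w n x + g n x) x)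
    (hg : ∀ n, ContinuousOn (g n) (Ioo c d))
    (bw : ∀ n, ∀ x ∈ Ioo c d, |w n x| ≤ C / sineFreq n ^ 4)
    (bw' : ∀ n, ∀ x ∈ Ioo c d, |w' n x| ≤ C / sineFreq n ^ 3)
    (bg : ∀ n, ∀ x ∈ Ioo c d, |g n x| ≤ C / sineFreq n ^ 2) :
    ContDiffOn ℝ 2 (fun p : ℝ × ℝ => ∑' n, w n p.1 * Real.sin (sineFreq n * p.2))
      (Ioo c d ×ˢ univ) ∧
    ∀ p ∈ Ioo c d ×ˢ (univ : Set ℝ),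
      laplacian2 (fun p : ℝ × ℝ => ∑' n, w n p.1 * Real.sin (sineFreq n * p.2)) p =
        ∑' n, g n p.1 * Real.sin (sineFreq n * p.2) := by
  have hs : IsOpen (Ioo c d ×ˢ (univ : Set ℝ)) := isOpen_Ioo.prod isOpen_univ
  set w'' : ℕ → ℝ → ℝ := fun n x => sineFreq n ^ 2 * w n x + g n x with hw''
  set σ : ℕ → ℝ → ℝ := fun n y => Real.sin (sineFreq n * y) with hσ
  set σ' : ℕ → ℝ → ℝ := fun n y => sineFreq n * Real.cos (sineFreq n * y) with hσ'
  set σ'' : ℕ → ℝ → ℝ := fun n y => -(sineFreq n ^ 2 * Real.sin (sineFreq n * y)) with hσ''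
  have dσ : ∀ n y, HasDerivAt (σ n) (σ' n y) y := fun n y =>
    (((hasDerivAt_id y).const_mul (sineFreq n)).sin).congr_deriv (by
      simp only [hσ', id]; ring)
  have dσ' : ∀ n y, HasDerivAt (σ' n) (σ'' n y) y := fun n y =>
    ((((hasDerivAt_id y).const_mul (sineFreq n)).cos).const_mul (sineFreq n)).congr_deriv (by
      simp only [hσ'', id]; ring)
  have hK := one_le_sineFreq
  have hK0 := sineFreq_pos
  have bσ : ∀ n y, |σ n y| ≤ 1 := fun n y => Real.abs_sin_le_one _
  have bσ' : ∀ n y, |σ' n y| ≤ sineFreq n := fun n y => by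
    simp only [hσ', abs_mul, abs_of_pos (hK0 n)]
    exact mul_le_of_le_one_right (hK0 n).le (Real.abs_cos_le_one _)
  have bσ'' : ∀ n y, |σ'' n y| ≤ sineFreq n ^ 2 := fun n y => by
    simp only [hσ'', abs_neg, abs_mul, abs_of_pos (pow_pos (hK0 n) 2)]
    exact mul_le_of_le_one_right (by positivity) (Real.abs_sin_le_one _)
  have bw'' : ∀ n, ∀ x ∈ Ioo c d, |w'' n x| ≤ 2 * C / sineFreq n ^ 2 := fun n x hx => by
    have e1 : |sineFreq n ^ 2 * w n x| ≤ C / sineFreq n ^ 2 := by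
      rw [abs_mul, abs_of_pos (pow_pos (hK0 n) 2)]
      calc _ ≤ sineFreq n ^ 2 * (C / sineFreq n ^ 4) := by gcongr; exact bw n x hx
        _ = _ := by have := (hK0 n).ne'; field_simp
    calc _ ≤ _ := abs_add_le _ _
      _ ≤ C / sineFreq n ^ 2 + C / sineFreq n ^ 2 := add_le_add e1 (bg n x hx)
      _ = _ := by ring
  -- a product of bounds `C / k ^ i` and `k ^ j` with `j + 2 ≤ i` is at most `2 * C / k ^ 2`
  have prod_bound : ∀ (n : ℕ) (i j : ℕ) (s t : ℝ), j + 2 ≤ i → |s| ≤ C / sineFreq n ^ i →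
      |t| ≤ sineFreq n ^ j → |s * t| ≤ 2 * C / sineFreq n ^ 2 := by
    intro n i j s t hij hs ht
    have hk := hK0 n
    have hC : 0 ≤ C := by
      have := (abs_nonneg s).trans hs
      by_contra! hC
      exact absurd (div_neg_of_neg_of_pos hC (pow_pos hk i)) (not_lt.2 this)
    rw [abs_mul]
    calc |s| * |t| ≤ C / sineFreq n ^ i * sineFreq n ^ j := by gcongr
      _ ≤ C / sineFreq n ^ (j + 2) * sineFreq n ^ j := by
        gcongr; exact hK n
      _ = C / sineFreq n ^ 2 := by rw [pow_add]; field_simp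
      _ ≤ 2 * C / sineFreq n ^ 2 := by gcongr; linarith
  have hsum := summable_div_sineFreq_sq (2 * C)
  have P00 : ∀ n, ∀ x ∈ Ioo c d, ∀ y, |w n x * σ n y| ≤ 2 * C / sineFreq n ^ 2 :=
    fun n x hx y => prod_bound n 4 0 _ _ (by norm_num) (bw n x hx) (by simpa using bσ n y)
  have P10 : ∀ n, ∀ x ∈ Ioo c d, ∀ y, |w' n x * σ n y| ≤ 2 * C / sineFreq n ^ 2 :=
    fun n x hx y => prod_bound n 3 0 _ _ (by norm_num) (bw' n x hx) (by simpa using bσ n y)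
  have P01 : ∀ n, ∀ x ∈ Ioo c d, ∀ y, |w n x * σ' n y| ≤ 2 * C / sineFreq n ^ 2 :=
    fun n x hx y => prod_bound n 4 1 _ _ (by norm_num) (bw n x hx) (by simpa using bσ' n y)
  have P11 : ∀ n, ∀ x ∈ Ioo c d, ∀ y, |w' n x * σ' n y| ≤ 2 * C / sineFreq n ^ 2 :=
    fun n x hx y => prod_bound n 3 1 _ _ (by norm_num) (bw' n x hx) (by simpa using bσ' n y)
  have P02 : ∀ n, ∀ x ∈ Ioo c d, ∀ y, |w n x * σ'' n y| ≤ 2 * C / sineFreq n ^ 2 :=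
    fun n x hx y => prod_bound n 4 2 _ _ (by norm_num) (bw n x hx) (bσ'' n y)
  have P20 : ∀ n, ∀ x ∈ Ioo c d, ∀ y, |w'' n x * σ n y| ≤ 2 * C / sineFreq n ^ 2 :=
    fun n x hx y => by
      rw [abs_mul]
      exact (mul_le_of_le_one_right (abs_nonneg _) (bσ n y)).trans (bw'' n x hx)
  have D : ∀ p ∈ Ioo c d ×ˢ (univ : Set ℝ), _ := fun p hp =>
    hasFDerivAt_tsum_mul hsum hw dσ P00 P10 P01 hp
  have Dx : ∀ p ∈ Ioo c d ×ˢ (univ : Set ℝ), _ := fun p hp =>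
    hasFDerivAt_tsum_mul hsum hw' dσ P10 P20 P11 hp
  have Dy : ∀ p ∈ Ioo c d ×ˢ (univ : Set ℝ), _ := fun p hp =>
    hasFDerivAt_tsum_mul hsum hw dσ' P01 P11 P02 hp
  have hcont : ∀ (a b : ℕ → ℝ → ℝ), (∀ n, ContinuousOn (a n) (Ioo c d)) →
      (∀ n, Continuous (b n)) →
      (∀ n, ∀ x ∈ Ioo c d, ∀ y, |a n x * b n y| ≤ 2 * C / sineFreq n ^ 2) →
      ContDiffOn ℝ ((0 : ℕ) : WithTop ℕ∞) (fun p : ℝ × ℝ => ∑' n, a n p.1 * b n p.2)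
        (Ioo c d ×ˢ univ) := by
    intro a b ha hb hab
    refine contDiffOn_zero.2 (continuousOn_tsum (fun n => ?_) hsum
      fun n p hp => hab n p.1 hp.1 p.2)
    exact ((ha n).comp continuousOn_fst fun p hp => hp.1).mul
      ((hb n).comp continuous_snd).continuousOn
  have cw : ∀ n, ContinuousOn (w n) (Ioo c d) := fun n x hx =>
    (hw n x hx).continuousAt.continuousWithinAt
  have cw' : ∀ n, ContinuousOn (w' n) (Ioo c d) := fun n x hx =>
    (hw' n x hx).continuousAt.continuousWithinAt
  have cw'' : ∀ n, ContinuousOn (w'' n) (Ioo c d) := fun n =>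
    (continuousOn_const.mul (cw n)).add (hg n)
  have cσ : ∀ n, Continuous (σ n) := fun n => by fun_prop
  have cσ' : ∀ n, Continuous (σ' n) := fun n => by fun_prop
  have cσ'' : ∀ n, Continuous (σ'' n) := fun n => by fun_prop
  refine ⟨?_, fun p hp => ?_⟩
  · exact contDiffOn_succ_of_hasFDerivAt_fst_snd (m := 1) hs D
      (contDiffOn_succ_of_hasFDerivAt_fst_snd (m := 0) hs Dx (hcont _ _ cw'' cσ P20)
        (hcont _ _ cw' cσ' P11))
      (contDiffOn_succ_of_hasFDerivAt_fst_snd (m := 0) hs Dy (hcont _ _ cw' cσ' P11)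
        (hcont _ _ cw cσ'' P02))
  · have e1 : deriv (fun s => ∑' n, w n s * σ n p.2) =ᶠ[nhds p.1]
        fun s => ∑' n, w' n s * σ n p.2 := by
      filter_upwards [isOpen_Ioo.mem_nhds hp.1] with s hs
      exact (D (s, p.2) ⟨hs, mem_univ _⟩).hasDerivAt_slices.1.deriv
    have e2 : deriv (fun s => ∑' n, w n p.1 * σ n s) = fun s => ∑' n, w n p.1 * σ' n s := by
      funext s
      exact (D (p.1, s) ⟨hp.1, mem_univ _⟩).hasDerivAt_slices.2.deriv
    have s1 : Summable fun n => w'' n p.1 * σ n p.2 :=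
      hsum.of_norm_bounded fun n => P20 n p.1 hp.1 p.2
    have s2 : Summable fun n => w n p.1 * σ'' n p.2 :=
      hsum.of_norm_bounded fun n => P02 n p.1 hp.1 p.2
    simp only [laplacian2]
    change deriv (deriv (fun s => ∑' n, w n s * σ n p.2)) p.1 +
      deriv (deriv (fun s => ∑' n, w n p.1 * σ n s)) p.2 = _
    rw [e1.deriv_eq, (Dx p hp).hasDerivAt_slices.1.deriv, e2,
      (Dy p hp).hasDerivAt_slices.2.deriv, ← s1.tsum_add s2]
    refine tsum_congr fun n => ?_
    simp only [hw'', hσ'', hσ]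
    ring

/-- `g n` are the sine coefficients of `f` on `[0, 1]²`, and `p n` solves `w'' = k² w + g n` for
the `n`-th frequency `k`, with derivative `q n`. -/
structure IsSineModes (f : ℝ × ℝ → ℝ) (C : ℝ) (g p q : ℕ → ℝ → ℝ) : Prop where
  nonneg : 0 ≤ C
  continuous : ∀ n, Continuous (g n)
  hasDerivAt : ∀ n x, HasDerivAt (p n) (q n x) x
  hasDerivAt' : ∀ n x, HasDerivAt (q n) (sineFreq n ^ 2 * p n x + g n x) x
  hasSum : ∀ x ∈ Icc (0 : ℝ) 1, ∀ y ∈ Icc (0 : ℝ) 1,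
    HasSum (fun n => g n x * Real.sin (sineFreq n * y)) (f (x, y))
  bound : ∀ n, ∀ x ∈ Icc (0 : ℝ) 1, |g n x| ≤ C / sineFreq n ^ 2
  bound_sol : ∀ n, ∀ x ∈ Icc (0 : ℝ) 1, |p n x| ≤ C / sineFreq n ^ 4
  bound_deriv : ∀ n, ∀ x ∈ Icc (0 : ℝ) 1, |q n x| ≤ C / sineFreq n ^ 3

theorem exists_isSineModes {f : ℝ × ℝ → ℝ} (hf : ContDiff ℝ 2 f)
    (hf0 : ∀ x, f (x, 0) = 0 ∧ f (x, 1) = 0) : ∃ C g p q, IsSineModes f C g p q := by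
  obtain ⟨g, C, hC, hg, hb, hsum⟩ := exists_sine_expansion hf hf0
  choose p q hp hq hpq using fun n => exists_particular_solution (hg n) (sineFreq_pos n) (hb n)
  refine ⟨C, g, p, q, hC, hg, hp, hq, hsum, hb, fun n x hx => ?_, fun n x hx => ?_⟩
  · exact (hpq n x hx).1.trans_eq (by rw [div_div, ← pow_add])
  · exact (hpq n x hx).2.trans_eq (by rw [div_div, ← pow_succ])

/-- The solution of `w'' = k² w + g` on `[a, b]` with `w a = A` and `w b = B`, built from a
particular solution `p`. -/
noncomputable def dirichletMode (p : ℝ → ℝ) (k a b A B x : ℝ) : ℝ :=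
  p x + (A - p a) * (Real.sinh (k * (b - x)) / Real.sinh (k * (b - a))) +
    (B - p b) * (Real.sinh (k * (x - a)) / Real.sinh (k * (b - a)))

/-- The derivative of `dirichletMode p k a b A B`, where `q` is the derivative of `p`. -/
noncomputable def dirichletModeDeriv (p q : ℝ → ℝ) (k a b A B x : ℝ) : ℝ :=
  q x - k * ((A - p a) * (Real.cosh (k * (b - x)) / Real.sinh (k * (b - a)))) +
    k * ((B - p b) * (Real.cosh (k * (x - a)) / Real.sinh (k * (b - a))))

section DirichletMode

variable {p q g : ℝ → ℝ} {k a b A B : ℝ}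

theorem sinh_mul_sub_ne_zero (hk : 0 < k) (hab : a < b) : Real.sinh (k * (b - a)) ≠ 0 :=
  (Real.sinh_pos_iff.2 (mul_pos hk (sub_pos.2 hab))).ne'

theorem dirichletMode_left (hk : 0 < k) (hab : a < b) : dirichletMode p k a b A B a = A := by
  simp [dirichletMode, sinh_mul_sub_ne_zero hk hab]

theorem dirichletMode_right (hk : 0 < k) (hab : a < b) : dirichletMode p k a b A B b = B := by
  simp [dirichletMode, sinh_mul_sub_ne_zero hk hab]

theorem hasDerivAt_dirichletMode (hp : ∀ x, HasDerivAt p (q x) x) (x : ℝ) :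
    HasDerivAt (dirichletMode p k a b A B) (dirichletModeDeriv p q k a b A B x) x := by
  have e1 := ((((((hasDerivAt_id x).const_sub b).const_mul k).sinh).div_const
    (Real.sinh (k * (b - a)))).const_mul (A - p a))
  have e2 := ((((((hasDerivAt_id x).sub_const a).const_mul k).sinh).div_const
    (Real.sinh (k * (b - a)))).const_mul (B - p b))
  refine (((hp x).add e1).add e2).congr_deriv ?_
  simp only [dirichletModeDeriv, id]
  ring

theorem hasDerivAt_dirichletModeDeriv (hq : ∀ x, HasDerivAt q (k ^ 2 * p x + g x) x) (x : ℝ) :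
    HasDerivAt (dirichletModeDeriv p q k a b A B) (k ^ 2 * dirichletMode p k a b A B x + g x)
      x := by
  have e1 := (((((((hasDerivAt_id x).const_sub b).const_mul k).cosh).div_const
    (Real.sinh (k * (b - a)))).const_mul (A - p a)).const_mul k)
  have e2 := (((((((hasDerivAt_id x).sub_const a).const_mul k).cosh).div_const
    (Real.sinh (k * (b - a)))).const_mul (B - p b)).const_mul k)
  refine (((hq x).sub e1).add e2).congr_deriv ?_
  simp only [dirichletMode, id]
  ring

theorem abs_dirichletMode_le (hk : 0 < k) (hab : a < b) {x : ℝ} (hx : x ∈ Icc a b) :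
    |dirichletMode p k a b A B x| ≤ |p x| + |A - p a| + |B - p b| := by
  have hL : 0 < b - a := sub_pos.2 hab
  refine (abs_add_three _ _ _).trans (add_le_add_three le_rfl ?_ ?_)
  · rw [abs_mul]
    exact mul_le_of_le_one_right (abs_nonneg _) (sinh_div_sinh_le_one hk hL
      ⟨by linarith [hx.2], by linarith [hx.1]⟩)
  · rw [abs_mul]
    exact mul_le_of_le_one_right (abs_nonneg _) (sinh_div_sinh_le_one hk hL
      ⟨by linarith [hx.1], by linarith [hx.2]⟩)

end DirichletMode

section Modes

variable {f : ℝ × ℝ → ℝ} {C C' a b : ℝ} {g p q : ℕ → ℝ → ℝ} {A B : ℕ → ℝ}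

theorem IsSineModes.abs_sub_le (h : IsSineModes f C g p q)
    (hA : ∀ n, |A n| ≤ C' / sineFreq n ^ 2) {x : ℝ} (hx : x ∈ Icc (0 : ℝ) 1) (n : ℕ) :
    |A n - p n x| ≤ (C + C') / sineFreq n ^ 2 := by
  have hC := h.nonneg
  have hk := sineFreq_pos n
  have h1 := one_le_sineFreq n
  have h2 : C / sineFreq n ^ 4 ≤ C / sineFreq n ^ 2 := by
    gcongr
    norm_num
  calc _ ≤ |A n| + |p n x| := abs_sub _ _
    _ ≤ C' / sineFreq n ^ 2 + C / sineFreq n ^ 2 :=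
      add_le_add (hA n) ((h.bound_sol n x hx).trans h2)
    _ = _ := by ring

theorem IsSineModes.abs_dirichletMode_le (h : IsSineModes f C g p q) (ha : 0 ≤ a) (hab : a < b)
    (hb : b ≤ 1) (hA : ∀ n, |A n| ≤ C' / sineFreq n ^ 2) (hB : ∀ n, |B n| ≤ C' / sineFreq n ^ 2)
    (n : ℕ) {x : ℝ} (hx : x ∈ Icc a b) :
    |dirichletMode (p n) (sineFreq n) a b (A n) (B n) x| ≤
      (3 * C + 2 * C') / sineFreq n ^ 2 := by
  have h0 := h.abs_sub_le (A := 0) (C' := 0) (by simp) ⟨ha.trans hx.1, hx.2.trans hb⟩ n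
  simp only [Pi.zero_apply, zero_sub, abs_neg, add_zero] at h0
  have h1 := h.abs_sub_le hA (x := a) ⟨ha, hab.le.trans hb⟩ n
  have h2 := h.abs_sub_le hB (x := b) ⟨ha.trans hab.le, hb⟩ n
  calc _ ≤ _ := _root_.abs_dirichletMode_le (sineFreq_pos n) hab hx
    _ ≤ C / sineFreq n ^ 2 + (C + C') / sineFreq n ^ 2 + (C + C') / sineFreq n ^ 2 :=
      add_le_add_three h0 h1 h2
    _ = _ := by ring

theorem IsSineModes.regular (h : IsSineModes f C g p q) (ha : 0 ≤ a) (hab : a < b)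
    (hb : b ≤ 1) (hA : ∀ n, |A n| ≤ C' / sineFreq n ^ 2) (hB : ∀ n, |B n| ≤ C' / sineFreq n ^ 2)
    {u : ℝ × ℝ → ℝ} (hu : ∀ r ∈ Ioo a b ×ˢ (univ : Set ℝ), u r =
      ∑' n, dirichletMode (p n) (sineFreq n) a b (A n) (B n) r.1 * Real.sin (sineFreq n * r.2)) :
    ContDiffOn ℝ 2 u (Ioo a b ×ˢ Ioo 0 1) ∧
      ∀ r ∈ Ioo a b ×ˢ Ioo (0 : ℝ) 1, laplacian2 u r = f r := by
  have hC := h.nonneg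
  have hC' : 0 ≤ C' := by
    have := (abs_nonneg _).trans (hA 0)
    by_contra! hC
    exact absurd (div_neg_of_neg_of_pos hC (pow_pos (sineFreq_pos 0) 2)) (not_lt.2 this)
  have key : ∀ r ∈ Ioo a b ×ˢ Ioo (0 : ℝ) 1, ContDiffAt ℝ 2 u r ∧ laplacian2 u r = f r := by
    rintro ⟨x, y⟩ ⟨hx, hy⟩
    obtain ⟨δ, hδ, hδx⟩ : ∃ δ > 0, x ∈ Ioo (a + δ) (b - δ) := by
      obtain ⟨h1, h2⟩ := hx
      simp only at h1 h2
      refine ⟨min (x - a) (b - x) / 2, by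
        have := lt_min (sub_pos.2 h1) (sub_pos.2 h2); linarith, ?_, ?_⟩
      · have := min_le_left (x - a) (b - x); linarith
      · have := min_le_right (x - a) (b - x); linarith
    have hsub : Ioo (a + δ) (b - δ) ⊆ Ioo a b := Ioo_subset_Ioo (by linarith) (by linarith)
    have hsub' : Ioo a b ⊆ Icc 0 1 := fun t ht => ⟨ha.trans ht.1.le, ht.2.le.trans hb⟩
    obtain ⟨D, hD, hdec⟩ := exists_cosh_div_sinh_le (sub_pos.2 hab) hδ
    set N := C + C' with hN
    have hN0 : 0 ≤ N := by positivity
    have bA := h.abs_sub_le hA (x := a) ⟨ha, hab.le.trans hb⟩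
    have bB := h.abs_sub_le hB (x := b) ⟨ha.trans hab.le, hb⟩
    obtain ⟨R1, R2⟩ := sineSeries_regular
      (w := fun n => dirichletMode (p n) (sineFreq n) a b (A n) (B n))
      (w' := fun n => dirichletModeDeriv (p n) (q n) (sineFreq n) a b (A n) (B n))
      (g := g) (c := a + δ) (d := b - δ) (C := C + 2 * (N * D))
      (fun n t _ => hasDerivAt_dirichletMode (h.hasDerivAt n) t)
      (fun n t _ => hasDerivAt_dirichletModeDeriv (h.hasDerivAt' n) t)
      (fun n => (h.continuous n).continuousOn)
      (fun n t ht => by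
        have hk := sineFreq_pos n
        have d1 := (hdec _ (one_le_sineFreq n) (b - t) (by linarith [ht.2]) (by linarith [ht.1])).2
        have d2 := (hdec _ (one_le_sineFreq n) (t - a) (by linarith [ht.1]) (by linarith [ht.2])).2
        refine (abs_add_three _ _ _).trans ?_
        rw [abs_mul, abs_mul]
        calc _ ≤ C / sineFreq n ^ 4 + N / sineFreq n ^ 2 * (D / sineFreq n ^ 2) +
              N / sineFreq n ^ 2 * (D / sineFreq n ^ 2) :=
              add_le_add_three (h.bound_sol n t (hsub' (hsub ht)))
                (mul_le_mul (bA n) d1 (abs_nonneg _) (by positivity))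
                (mul_le_mul (bB n) d2 (abs_nonneg _) (by positivity))
          _ = _ := by field_simp; ring)
      (fun n t ht => by
        have hk := sineFreq_pos n
        have d1 := (hdec _ (one_le_sineFreq n) (b - t) (by linarith [ht.2]) (by linarith [ht.1])).1
        have d2 := (hdec _ (one_le_sineFreq n) (t - a) (by linarith [ht.1]) (by linarith [ht.2])).1
        rw [dirichletModeDeriv, sub_eq_add_neg]
        refine (abs_add_three _ _ _).trans ?_
        rw [abs_neg, abs_mul, abs_mul, abs_mul, abs_mul, abs_of_pos hk]
        calc _ ≤ C / sineFreq n ^ 3 + sineFreq n * (N / sineFreq n ^ 2 * (D / sineFreq n ^ 2)) +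
              sineFreq n * (N / sineFreq n ^ 2 * (D / sineFreq n ^ 2)) :=
              add_le_add_three (h.bound_deriv n t (hsub' (hsub ht)))
                (mul_le_mul_of_nonneg_left
                  (mul_le_mul (bA n) d1 (abs_nonneg _) (by positivity)) hk.le)
                (mul_le_mul_of_nonneg_left
                  (mul_le_mul (bB n) d2 (abs_nonneg _) (by positivity)) hk.le)
          _ = _ := by field_simp; ring)
      (fun n t ht => (h.bound n t (hsub' (hsub ht))).trans (by
        have := mul_nonneg hN0 hD
        gcongr
        linarith))
    have hopen : IsOpen (Ioo (a + δ) (b - δ) ×ˢ (univ : Set ℝ)) := isOpen_Ioo.prod isOpen_univ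
    have hmem : (x, y) ∈ Ioo (a + δ) (b - δ) ×ˢ (univ : Set ℝ) := ⟨hδx, mem_univ _⟩
    have heq : u =ᶠ[nhds (x, y)] fun r => ∑' n, dirichletMode (p n) (sineFreq n) a b (A n) (B n)
        r.1 * Real.sin (sineFreq n * r.2) := by
      filter_upwards [hopen.mem_nhds hmem] with r hr
      exact hu r ⟨hsub hr.1, hr.2⟩
    refine ⟨(R1.contDiffAt (hopen.mem_nhds hmem)).congr_of_eventuallyEq heq, ?_⟩
    have e1 : (fun t => u (t, y)) =ᶠ[nhds x] fun t => ∑' n, dirichletMode (p n) (sineFreq n) a b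
        (A n) (B n) t * Real.sin (sineFreq n * y) :=
      (show ContinuousAt (fun t : ℝ => (t, y)) x by fun_prop).eventually heq
    have e2 : (fun t => u (x, t)) =ᶠ[nhds y] fun t => ∑' n, dirichletMode (p n) (sineFreq n) a b
        (A n) (B n) x * Real.sin (sineFreq n * t) :=
      (show ContinuousAt (fun t : ℝ => (x, t)) y by fun_prop).eventually heq
    rw [← (h.hasSum x (hsub' hx) y ⟨hy.1.le, hy.2.le⟩).tsum_eq, ← R2 (x, y) hmem, laplacian2,
      laplacian2]
    simp only
    rw [e1.deriv.deriv_eq, e2.deriv.deriv_eq]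
  exact ⟨fun r hr => (key r hr).1.contDiffWithinAt, fun r hr => (key r hr).2⟩

end Modes

theorem sinh_div_sinh_le_exp {k x y L : ℝ} (hk : 1 ≤ k) (hx : 0 < x) (hxy : x ≤ y) (hyL : y ≤ L) :
    0 ≤ Real.sinh (k * x) / Real.sinh (k * L) ∧
      Real.sinh (k * x) / Real.sinh (k * L) ≤ Real.exp (-(y - x)) := by
  have hk0 : 0 < k := zero_lt_one.trans_le hk
  have hs : 0 < Real.sinh (k * L) := Real.sinh_pos_iff.2 (mul_pos hk0 (by linarith))
  have hs' : 0 < Real.sinh (k * x) := Real.sinh_pos_iff.2 (by positivity)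
  refine ⟨by positivity, ?_⟩
  rw [div_le_iff₀ hs]
  refine (Real.sinh_le_exp_sub_mul_sinh (b := k * L) (by gcongr; linarith)).trans ?_
  exact mul_le_mul_of_nonneg_right (Real.exp_le_exp.2 (by
    nlinarith [mul_le_mul_of_nonneg_right hk (sub_nonneg.2 hxy),
      mul_le_mul_of_nonneg_left hyL hk0.le])) hs.le

/-- The value `τ` on the contact line solving the scalar nonlocal condition, with a bound. -/
theorem exists_contact_value {γm γp Sm Sp r z₁ z₂ φ N₁ N₂ N₃ : ℝ} (hγm : 0 < γm) (hγp : 0 < γp)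
    (hsum : γm + γp ≤ 1) (hr0 : 0 ≤ r) (hr : r < 1) (hSm : Sm ≤ r) (hSp : Sp ≤ r)
    (hz₁ : |z₁| ≤ N₁) (hz₂ : |z₂| ≤ N₂) (hφ : |φ| ≤ N₃) :
    ∃ τ, τ = γm * (z₁ + τ * Sm) + γp * (z₂ + τ * Sp) + φ ∧ |τ| ≤ (N₁ + N₂ + N₃) / (1 - r) := by
  have hd : 1 - r ≤ 1 - γm * Sm - γp * Sp := by nlinarith
  have hr' : 0 < 1 - r := sub_pos.2 hr
  have hd' : 0 < 1 - γm * Sm - γp * Sp := hr'.trans_le hd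
  refine ⟨(γm * z₁ + γp * z₂ + φ) / (1 - γm * Sm - γp * Sp), ?_, ?_⟩
  · field_simp
    ring
  · rw [abs_div, abs_of_pos hd']
    have h1 : |γm * z₁ + γp * z₂ + φ| ≤ N₁ + N₂ + N₃ := by
      refine (abs_add_three _ _ _).trans (add_le_add_three ?_ ?_ hφ)
      · rw [abs_mul, abs_of_pos hγm]
        exact (mul_le_of_le_one_left (abs_nonneg _) (by linarith)).trans hz₁
      · rw [abs_mul, abs_of_pos hγp]
        exact (mul_le_of_le_one_left (abs_nonneg _) (by linarith)).trans hz₂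
    exact div_le_div₀ ((abs_nonneg _).trans h1) h1 hr' hd

theorem exists_isRegSolPoisson (ξm ξ0 ξp γm γp : ℝ)
    (hξm0 : 0 < ξm) (hξm : ξm < ξ0) (hξp : ξ0 < ξp) (hξp1 : ξp < 1)
    (hγm : 0 < γm) (hγp : 0 < γp) (hsum : γm + γp ≤ 1)
    (fm fp : ℝ × ℝ → ℝ) (φ0 : ℝ → ℝ)
    (hfm : ContDiff ℝ 2 fm) (hfp : ContDiff ℝ 2 fp) (hφ0 : ContDiff ℝ 2 φ0)
    (hfm0 : ∀ x₁ : ℝ, fm (x₁, 0) = 0 ∧ fm (x₁, 1) = 0)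
    (hfp0 : ∀ x₁ : ℝ, fp (x₁, 0) = 0 ∧ fp (x₁, 1) = 0)
    (hφ00 : φ0 0 = 0 ∧ φ0 1 = 0) :
    ∃ u : ℝ × ℝ → ℝ, IsRegSolPoisson ξm ξ0 ξp γm γp fm fp φ0 u := by
  have hξ0 : 0 < ξ0 := hξm0.trans hξm
  have hξ1 : ξ0 < 1 := hξp.trans hξp1
  have hK := one_le_sineFreq
  have hK0 := sineFreq_pos
  obtain ⟨C₁, g₁, p₁, q₁, h₁⟩ := exists_isSineModes hfm hfm0
  obtain ⟨C₂, g₂, p₂, q₂, h₂⟩ := exists_isSineModes hfp hfp0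
  obtain ⟨a, C₃, hC₃, -, hab, has⟩ := exists_sine_expansion (F := fun z => φ0 z.2)
    (by fun_prop) (fun _ => hφ00)
  have hz : ∀ n, |(0 : ℕ → ℝ) n| ≤ 0 / sineFreq n ^ 2 := by simp
  set r := max (Real.exp (-(ξ0 - ξm))) (Real.exp (-((1 - ξ0) - (1 - ξp)))) with hr
  have hr1 : r < 1 := max_lt (by rw [Real.exp_lt_one_iff]; linarith)
    (by rw [Real.exp_lt_one_iff]; linarith)
  have hr0 : 0 ≤ r := (Real.exp_pos _).le.trans (le_max_left _ _)
  choose τ hτ hτb using fun n => exists_contact_value (r := r)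
    (Sm := Real.sinh (sineFreq n * (ξm - 0)) / Real.sinh (sineFreq n * (ξ0 - 0)))
    (Sp := Real.sinh (sineFreq n * (1 - ξp)) / Real.sinh (sineFreq n * (1 - ξ0)))
    hγm hγp hsum hr0 hr1
    ((sinh_div_sinh_le_exp (hK n) (by linarith) (y := ξ0) (by linarith) (by linarith)).2.trans
      (by simp [hr]))
    ((sinh_div_sinh_le_exp (hK n) (by linarith) (y := 1 - ξ0) (by linarith)
      (by linarith)).2.trans (by simp [hr]))
    (h₁.abs_dirichletMode_le le_rfl hξ0 hξ1.le hz hz n (x := ξm) ⟨hξm0.le, hξm.le⟩)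
    (h₂.abs_dirichletMode_le hξ0.le hξ1 le_rfl hz hz n (x := ξp) ⟨hξp.le, hξp1.le⟩)
    (hab n 0 (by simp))
  simp only [Pi.zero_apply] at hτ
  set C' := (3 * C₁ + 2 * 0 + (3 * C₂ + 2 * 0) + C₃) / (1 - r) with hC'
  have hτb' : ∀ n, |τ n| ≤ C' / sineFreq n ^ 2 := fun n =>
    (hτb n).trans_eq (by rw [hC']; ring)
  have hC₁ := h₁.nonneg
  have hC₂ := h₂.nonneg
  have hC'0 : 0 ≤ C' := div_nonneg (by positivity) (sub_nonneg.2 hr1.le)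
  have hz' : ∀ n, |(0 : ℕ → ℝ) n| ≤ C' / sineFreq n ^ 2 := fun n => by
    simp only [Pi.zero_apply, abs_zero]; positivity
  set wL : ℕ → ℝ → ℝ := fun n => dirichletMode (p₁ n) (sineFreq n) 0 ξ0 0 (τ n) with hwL
  set wR : ℕ → ℝ → ℝ := fun n => dirichletMode (p₂ n) (sineFreq n) ξ0 1 (τ n) 0 with hwR
  have wL0 : ∀ n, wL n 0 = 0 := fun n => dirichletMode_left (hK0 n) hξ0
  have wLξ : ∀ n, wL n ξ0 = τ n := fun n => dirichletMode_right (hK0 n) hξ0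
  have wRξ : ∀ n, wR n ξ0 = τ n := fun n => dirichletMode_left (hK0 n) hξ1
  have wR1 : ∀ n, wR n 1 = 0 := fun n => dirichletMode_right (hK0 n) hξ1
  have cL : ∀ n, Continuous (wL n) := fun n => continuous_iff_continuousAt.2 fun x =>
    (hasDerivAt_dirichletMode (h₁.hasDerivAt n) x).continuousAt
  have cR : ∀ n, Continuous (wR n) := fun n => continuous_iff_continuousAt.2 fun x =>
    (hasDerivAt_dirichletMode (h₂.hasDerivAt n) x).continuousAt
  set w : ℕ → ℝ → ℝ := fun n x => if x ≤ ξ0 then wL n x else wR n x with hw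
  have wl : ∀ n, ∀ x ≤ ξ0, w n x = wL n x := fun n x hx => if_pos hx
  have wr : ∀ n x, ξ0 ≤ x → w n x = wR n x := fun n x hx => by
    rcases hx.eq_or_lt with rfl | hx
    · rw [wl n _ le_rfl, wLξ, wRξ]
    · exact if_neg (not_le.2 hx)
  have cw : ∀ n, Continuous (w n) := fun n =>
    Continuous.if_le (cL n) (cR n) continuous_id continuous_const
      (fun x hx => by rw [show x = ξ0 from hx, wLξ, wRξ])
  set N := (3 * C₁ + 2 * C') + (3 * C₂ + 2 * C') with hN
  have bw : ∀ n, ∀ x ∈ Icc (0 : ℝ) 1, ∀ y, ‖w n x * Real.sin (sineFreq n * y)‖ ≤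
      N / sineFreq n ^ 2 := fun n x hx y => by
    rw [norm_mul]
    refine (mul_le_of_le_one_right (norm_nonneg _) (Real.abs_sin_le_one _)).trans ?_
    rcases le_total x ξ0 with h | h
    · rw [wl n x h]
      refine (h₁.abs_dirichletMode_le le_rfl hξ0 hξ1.le hz' hτb' n ⟨hx.1, h⟩).trans ?_
      gcongr
      linarith
    · rw [wr n x h]
      refine (h₂.abs_dirichletMode_le hξ0.le hξ1 le_rfl hτb' hz' n ⟨h, hx.2⟩).trans ?_
      gcongr
      linarith
  have hNs := summable_div_sineFreq_sq N
  have hsw : ∀ x ∈ Icc (0 : ℝ) 1, ∀ y, Summable fun n => w n x * Real.sin (sineFreq n * y) :=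
    fun x hx y => hNs.of_norm_bounded fun n => bw n x hx y
  obtain ⟨L1, L2⟩ := h₁.regular le_rfl hξ0 hξ1.le hz' hτb'
    (u := fun z => ∑' n, w n z.1 * Real.sin (sineFreq n * z.2))
    (fun z hz => tsum_congr fun n => by rw [wl n _ hz.1.2.le]; rfl)
  obtain ⟨R1, R2⟩ := h₂.regular hξ0.le hξ1 le_rfl hτb' hz'
    (u := fun z => ∑' n, w n z.1 * Real.sin (sineFreq n * z.2))
    (fun z hz => tsum_congr fun n => by rw [wr n _ hz.1.1.le]; rfl)
  refine ⟨fun z => ∑' n, w n z.1 * Real.sin (sineFreq n * z.2), ?_, L1, R1, L2, R2,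
    fun x _ => ⟨?_, ?_⟩, fun y _ => ⟨?_, ?_⟩, fun y hy => ?_⟩
  · exact continuousOn_tsum (fun n => by
      have := cw n
      fun_prop) hNs fun n z hz => bw n z.1 hz.1 z.2
  · simp
  · have : ∀ n, Real.sin (sineFreq n) = 0 := fun n => by
      simpa [sineFreq] using Real.sin_nat_mul_pi (n + 1)
    simp [this]
  · simp [wl _ _ hξ0.le, wL0]
  · simp [wr _ _ hξ1.le, wR1]
  · have eφ := (has 0 (by simp) y hy)
    have em := (hsw ξm ⟨hξm0.le, by linarith⟩ y).hasSum.mul_left γm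
    have ep := (hsw ξp ⟨by linarith, hξp1.le⟩ y).hasSum.mul_left γp
    rw [← ((em.add ep).add eφ).tsum_eq]
    refine tsum_congr fun n => ?_
    have e1 : w n ξm = dirichletMode (p₁ n) (sineFreq n) 0 ξ0 0 0 ξm +
        τ n * (Real.sinh (sineFreq n * (ξm - 0)) / Real.sinh (sineFreq n * (ξ0 - 0))) := by
      rw [wl n _ hξm.le]; simp only [hwL, dirichletMode]; ring
    have e2 : w n ξp = dirichletMode (p₂ n) (sineFreq n) ξ0 1 0 0 ξp +
        τ n * (Real.sinh (sineFreq n * (1 - ξp)) / Real.sinh (sineFreq n * (1 - ξ0))) := by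
      rw [wr n _ hξp.le]; simp only [hwR, dirichletMode]; ring
    simp only
    rw [wl n _ le_rfl, wLξ, e1, e2]
    linear_combination Real.sin (sineFreq n * y) * hτ n

/-- Theorem 1: existence and uniqueness of the regular solution of
the nonlocal contact problem for the Poisson equation on the unit square. -/
theorem stmt_5 (ξm ξ0 ξp γm γp : ℝ)
    (hξm0 : 0 < ξm) (hξm : ξm < ξ0) (hξp : ξ0 < ξp) (hξp1 : ξp < 1)
    (hγm : 0 < γm) (hγp : 0 < γp) (hsum : γm + γp ≤ 1)
    (fm fp : ℝ × ℝ → ℝ) (φ0 : ℝ → ℝ)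
    (hfm : ContDiff ℝ (⊤ : ℕ∞) fm) (hfp : ContDiff ℝ (⊤ : ℕ∞) fp) (hφ0 : ContDiff ℝ (⊤ : ℕ∞) φ0)
    (hfm0 : ∀ x₁ : ℝ, fm (x₁, 0) = 0 ∧ fm (x₁, 1) = 0)
    (hfp0 : ∀ x₁ : ℝ, fp (x₁, 0) = 0 ∧ fp (x₁, 1) = 0)
    (hφ00 : φ0 0 = 0 ∧ φ0 1 = 0) :
    ∃ u : ℝ × ℝ → ℝ, IsRegSolPoisson ξm ξ0 ξp γm γp fm fp φ0 u ∧
      ∀ v : ℝ × ℝ → ℝ, IsRegSolPoisson ξm ξ0 ξp γm γp fm fp φ0 v →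
        Set.EqOn v u (Icc 0 1 ×ˢ Icc 0 1) := by
  have h2 : ∀ {E : Type} [NormedAddCommGroup E] [NormedSpace ℝ E] {h : E → ℝ},
      ContDiff ℝ (⊤ : ℕ∞) h → ContDiff ℝ 2 h := fun hh => by
    exact_mod_cast contDiff_infty.1 hh 2
  obtain ⟨u, hu⟩ := exists_isRegSolPoisson ξm ξ0 ξp γm γp hξm0 hξm hξp hξp1 hγm hγp hsum
    fm fp φ0 (h2 hfm) (h2 hfp) (h2 hφ0) hfm0 hfp0 hφ00
  exact ⟨u, hu, fun v hv p hp => le_antisymm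
    (hu.le hξm0 hξm hξp hξp1 hγm hγp hsum hv p hp) (hv.le hξm0 hξm hξp hξp1 hγm hγp hsum hu p hp)⟩
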